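/- Let V be a finite-dimensional real inner product space with norm ‖·‖, and let A : V × V × V → ℝ be such that for every fixed κ ∈ V the map (u, v) ↦ A(κ; u, v) is bilinear, A(v; v, v) ≥ ν ‖v‖² for all v ∈ V with some ν > 0, and A is sequentially continuous in its first two arguments jointly (if κ_l → κ then A(κ_l; κ_l, v) → A(κ; κ, v) for all v). Then for every continuous linear functional F on V there exists u ∈ V with A(u; u, v) = F(v) for all v ∈ V. -/

import Mathlib

section

open Polynomial MeasureTheory Set Filter Topology Metric

/-- If the integral of a family of polynomials of bounded degree takes a constant value for all
parameters in `(0, τ]`, then it takes this value for all parameters. -/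
lemma integral_eval_eq_of_forall_mem_Ioc {α : Type*} [MeasurableSpace α] {μ : Measure α}
    (P : α → ℝ[X]) (d : ℕ) (hdeg : ∀ x, (P x).natDegree ≤ d)
    (hint : ∀ t, Integrable (fun x => (P x).eval t) μ) {c τ : ℝ} (hτ : 0 < τ)
    (h : ∀ t ∈ Ioc 0 τ, ∫ x, (P x).eval t ∂μ = c) (t : ℝ) :
    ∫ x, (P x).eval t ∂μ = c := by
  set s := Finset.range (d + 1)
  set v : ℕ → ℝ := fun i => τ / (i + 1)
  have hv : Set.InjOn v s := by
    intro i _ j _ hij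
    simp only [v] at hij
    field_simp at hij
    have : (j : ℝ) = i := by linarith
    exact_mod_cast this.symm
  have hmem : ∀ i, v i ∈ Ioc 0 τ := fun i =>
    ⟨by positivity, div_le_self hτ.le (by linarith [(Nat.cast_nonneg i : (0 : ℝ) ≤ i)])⟩
  have hP : ∀ (x : α) (u : ℝ), (P x).eval u =
      ∑ i ∈ s, (P x).eval (v i) * (Lagrange.basis s v i).eval u := by
    intro x u
    have hlt : (P x).degree < (s.card : ℕ) := by
      refine degree_le_natDegree.trans_lt ?_
      have := hdeg x
      simp only [s, Finset.card_range]
      exact_mod_cast Nat.lt_succ_of_le this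
    conv_lhs => rw [Lagrange.eq_interpolate hv hlt]
    simp [Lagrange.interpolate_apply, eval_finsetSum]
  have hs : s.Nonempty := ⟨0, by simp [s]⟩
  calc ∫ x, (P x).eval t ∂μ
      = ∫ x, ∑ i ∈ s, (P x).eval (v i) * (Lagrange.basis s v i).eval t ∂μ := by
        simp_rw [← hP]
    _ = ∑ i ∈ s, c * (Lagrange.basis s v i).eval t := by
        rw [integral_finsetSum _ fun i _ => (hint _).mul_const _]
        refine Finset.sum_congr rfl fun i _ => ?_
        rw [integral_mul_const, h _ (hmem i)]
    _ = c := by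
        rw [← Finset.mul_sum, ← eval_finsetSum, Lagrange.sum_basis hv hs, eval_one, mul_one]

/-- A perturbation of the identity by a contraction supported in a set maps this set bijectively
onto itself. -/
lemma LipschitzWith.injective_image_id_add {V : Type*} [NormedAddCommGroup V]
    [CompleteSpace V] {g : V → V} {K : NNReal}
    (hg : LipschitzWith K g) (hK : K < 1) {s : Set V} (hs : ∀ x ∉ s, g x = 0) :
    Function.Injective (fun x => x + g x) ∧ (fun x => x + g x) '' s = s := by
  have hinj : Function.Injective (fun x => x + g x) := by
    intro x y hxy
    have h1 : x - y = g y - g x := by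
      have : x + g x = y + g y := hxy
      rw [sub_eq_sub_iff_add_eq_add, this, add_comm]
    have h2 := hg.dist_le_mul y x
    rw [dist_eq_norm, dist_eq_norm, ← h1, norm_sub_rev y x] at h2
    have h3 : (K : ℝ) < 1 := hK
    have h4 : ‖x - y‖ = 0 := by nlinarith [norm_nonneg (x - y)]
    exact sub_eq_zero.mp (norm_eq_zero.mp h4)
  refine ⟨hinj, Subset.antisymm ?_ ?_⟩
  · rintro _ ⟨x, hx, rfl⟩
    by_contra hn
    have : x + g x = x := hinj (by simp [hs _ hn])
    exact hn (by simpa [this] using hx)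
  · intro y hy
    have hc : ContractingWith K (fun x => y - g x) :=
      ⟨hK, LipschitzWith.of_dist_le_mul fun a b => by
        rw [dist_sub_left]; exact hg.dist_le_mul a b⟩
    obtain ⟨x, hx, -⟩ := hc.exists_fixedPoint 0 (edist_ne_top _ _)
    have hx' : x + g x = y := by
      have : y - g x = x := hx
      exact (sub_eq_iff_eq_add.mp this).symm
    refine ⟨x, ?_, hx'⟩
    by_contra hn
    rw [hs x hn, add_zero] at hx'
    exact hn (hx' ▸ hy)

variable {V : Type*} [NormedAddCommGroup V] [InnerProductSpace ℝ V]

lemma exists_polynomial_eval_eq_det_one_add_smul [FiniteDimensional ℝ V] (L : V →L[ℝ] V) :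
    ∃ p : ℝ[X], p.natDegree ≤ Module.finrank ℝ V ∧
      ∀ t : ℝ, p.eval t = (1 + t • L : V →L[ℝ] V).det := by
  set b := Module.finBasis ℝ V
  set A := LinearMap.toMatrix b b (L : V →ₗ[ℝ] V)
  refine ⟨Matrix.det ((X : ℝ[X]) • A.map C + (1 : Matrix _ _ ℝ).map C), ?_, fun t => ?_⟩
  · simpa using natDegree_det_X_add_C_le A 1
  · rw [ContinuousLinearMap.det, ← LinearMap.det_toMatrix b, ← coe_evalRingHom, RingHom.map_det]
    congr 1
    ext i j
    simp [A, LinearMap.toMatrix_apply, Matrix.one_apply, Finsupp.single_apply, add_comm, eq_comm,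
      apply_ite]
    ring

lemma exists_polynomial_eval_eq_pow_sub_norm_sq (M : ℝ) (N : ℕ) (x y : V) :
    ∃ p : ℝ[X], p.natDegree ≤ 2 * N ∧
      ∀ t : ℝ, p.eval t = (M - ‖x + t • y‖ ^ 2) ^ N := by
  refine ⟨(C (-‖y‖ ^ 2) * X ^ 2 + C (-2 * inner ℝ x y) * X + C (M - ‖x‖ ^ 2)) ^ N, ?_,
    fun t => ?_⟩
  · refine natDegree_pow_le.trans ?_
    rw [mul_comm]
    exact Nat.mul_le_mul_right _ natDegree_quadratic_le
  · rw [norm_add_sq_real, norm_smul, inner_smul_right, mul_pow, Real.norm_eq_abs, sq_abs]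
    simp only [eval_pow, eval_add, eval_mul, eval_C, eval_X]
    ring

lemma ContinuousLinearMap.det_one_add_smul_pos [FiniteDimensional ℝ V] (L : V →L[ℝ] V) {t : ℝ}
    (ht : 0 ≤ t) (h : t * ‖L‖ < 1) : 0 < (1 + t • L : V →L[ℝ] V).det := by
  have hcont : ContinuousOn (fun s : ℝ => (1 + s • L : V →L[ℝ] V).det) (Icc 0 t) :=
    (ContinuousLinearMap.continuous_det.comp (by fun_prop)).continuousOn
  by_contra! hneg
  have h0 : (1 + (0 : ℝ) • L : V →L[ℝ] V).det = 1 := by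
    simp [ContinuousLinearMap.det]
  obtain ⟨s, hs, hs0⟩ := intermediate_value_Icc' ht hcont ⟨hneg, h0.symm ▸ zero_le_one⟩
  have hlt : ‖-(s • L)‖ < 1 := by
    rw [norm_neg, norm_smul, Real.norm_of_nonneg hs.1]
    exact (mul_le_mul_of_nonneg_right hs.2 (norm_nonneg _)).trans_lt h
  have hu := isUnit_one_sub_of_norm_lt_one hlt
  rw [sub_neg_eq_add] at hu
  have hdet : IsUnit (1 + s • L : V →L[ℝ] V).det := by
    rw [ContinuousLinearMap.det]
    exact (hu.map ContinuousLinearMap.toLinearMapRingHom).map LinearMap.det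
  exact hdet.ne_zero hs0

/-- A continuously differentiable, compactly supported perturbation of the identity of a
finite-dimensional space has a zero. -/
theorem ContDiff.exists_add_eq_zero_of_hasCompactSupport [FiniteDimensional ℝ V] {g : V → V}
    (hg : ContDiff ℝ 1 g) (hsupp : HasCompactSupport g) : ∃ x, x + g x = 0 := by
  borelize V
  let _ : MeasureSpace V := measureSpaceOfInnerProductSpace
  by_contra! hne
  obtain ⟨K, hK⟩ := hg.lipschitzWith_of_hasCompactSupport hsupp one_ne_zero
  obtain ⟨R, hR0, hR⟩ := hsupp.isCompact.isBounded.subset_closedBall_lt 0 0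
  set B := closedBall (0 : V) R
  have hBc : IsCompact B := isCompact_closedBall _ _
  have hB0 : (0 : V) ∈ B := mem_closedBall_self hR0.le
  have hgB : ∀ x ∉ B, g x = 0 := fun x hx => image_eq_zero_of_notMem_tsupport fun h => hx (hR h)
  have hgc : Continuous g := hg.continuous
  have hDc : Continuous (fderiv ℝ g) := hg.continuous_fderiv one_ne_zero
  have hdetc : ∀ t : ℝ, Continuous fun x => (1 + t • fderiv ℝ g x : V →L[ℝ] V).det := fun t =>
    ContinuousLinearMap.continuous_det.comp (by fun_prop)
  have hderiv : ∀ (t : ℝ) (x : V),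
      HasFDerivAt (fun x => x + t • g x) (1 + t • fderiv ℝ g x : V →L[ℝ] V) x := fun t x =>
    (hasFDerivAt_id x).add ((hg.differentiable one_ne_zero x).hasFDerivAt.const_smul t)
  have hhc : Continuous fun x => x + g x := by fun_prop
  obtain ⟨x₀, hx₀, hmin⟩ := hBc.exists_isMinOn ⟨0, hB0⟩ hhc.norm.continuousOn
  obtain ⟨C₁, hC₁⟩ := hBc.exists_bound_of_continuousOn hhc.continuousOn
  obtain ⟨δ, hδ0, hδR, hδ⟩ : ∃ δ > 0, δ ≤ R ∧ ∀ x ∈ B, δ ≤ ‖x + g x‖ :=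
    ⟨min R ‖x₀ + g x₀‖, lt_min hR0 (norm_pos_iff.mpr (hne x₀)), min_le_left _ _,
      fun x hx => (min_le_right _ _).trans (hmin hx)⟩
  obtain ⟨M, hMR, hMC⟩ : ∃ M, R ^ 2 < M ∧ ∀ x ∈ B, ‖x + g x‖ ^ 2 ≤ M :=
    ⟨max (R ^ 2 + 1) (C₁ ^ 2), (lt_add_one _).trans_le (le_max_left _ _), fun x hx =>
      (pow_le_pow_left₀ (norm_nonneg _) (hC₁ x hx) 2).trans (le_max_right _ _)⟩
  have hδM : δ ^ 2 < M := (pow_le_pow_left₀ hδ0.le hδR 2).trans_lt hMR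
  have hconst : ∀ N : ℕ, ∫ x in B, (M - ‖x + g x‖ ^ 2) ^ N * (1 + fderiv ℝ g x : V →L[ℝ] V).det
      = ∫ x in B, (M - ‖x‖ ^ 2) ^ N := by
    intro N
    choose p hpd hp using fun x => exists_polynomial_eval_eq_pow_sub_norm_sq M N x (g x)
    choose q hqd hq using fun x => exists_polynomial_eval_eq_det_one_add_smul (fderiv ℝ g x)
    have hev : ∀ x t, (p x * q x).eval t =
        (M - ‖x + t • g x‖ ^ 2) ^ N * (1 + t • fderiv ℝ g x : V →L[ℝ] V).det := fun x t => by
      rw [eval_mul, hp, hq]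
    have key := integral_eval_eq_of_forall_mem_Ioc (μ := volume.restrict B) (fun x => p x * q x)
      (2 * N + Module.finrank ℝ V)
      (fun x => natDegree_mul_le.trans (add_le_add (hpd x) (hqd x)))
      (fun t => by
        simp_rw [hev]
        have := hdetc t
        exact (Continuous.continuousOn (by fun_prop)).integrableOn_compact hBc)
      (c := ∫ x in B, (M - ‖x‖ ^ 2) ^ N) (τ := 1 / (K + 1)) (by positivity)
      (fun t ht => by
        simp_rw [hev]
        have htK : t * K < 1 := by
          have h1 := ht.2
          rw [le_div_iff₀ (by positivity)] at h1
          linarith [ht.1]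
        have hlip : LipschitzWith (⟨t, ht.1.le⟩ * K) fun x => t • g x :=
          LipschitzWith.of_dist_le_mul fun a b => by
            rw [dist_smul₀, Real.norm_of_nonneg ht.1.le]
            exact (mul_le_mul_of_nonneg_left (hK.dist_le_mul a b) ht.1.le).trans_eq
              (mul_assoc _ _ _).symm
        obtain ⟨hinj, himg⟩ := hlip.injective_image_id_add (s := B) (by exact_mod_cast htK)
          (fun x hx => by rw [hgB x hx, smul_zero])
        have hcov := integral_image_eq_integral_abs_det_fderiv_smul volume
          hBc.measurableSet (fun x _ => (hderiv t x).hasFDerivWithinAt) hinj.injOn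
          (fun y => (M - ‖y‖ ^ 2) ^ N)
        rw [himg] at hcov
        rw [hcov]
        refine integral_congr_ae (Eventually.of_forall fun x => ?_)
        have hpos := (fderiv ℝ g x).det_one_add_smul_pos ht.1.le
          ((mul_le_mul_of_nonneg_left (norm_fderiv_le_of_lipschitz ℝ hK) ht.1.le).trans_lt htK)
        simp only [abs_of_pos hpos, smul_eq_mul]
        ring) 1
    simpa only [hev, one_smul] using key
  set D := ∫ x in B, |(1 + fderiv ℝ g x : V →L[ℝ] V).det|
  have hdet1 : Continuous fun x => |(1 + fderiv ℝ g x : V →L[ℝ] V).det| := by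
    simpa only [one_smul] using (hdetc 1).abs
  have hupper : ∀ N : ℕ, ∫ x in B, (M - ‖x‖ ^ 2) ^ N ≤ (M - δ ^ 2) ^ N * D := by
    intro N
    rw [← hconst, ← integral_const_mul]
    have hd := hdetc 1
    simp only [one_smul] at hd
    refine setIntegral_mono_on ?_ ?_ hBc.measurableSet fun x hx => ?_
    · exact (Continuous.continuousOn (by fun_prop)).integrableOn_compact hBc
    · exact (Continuous.continuousOn (by fun_prop)).integrableOn_compact hBc
    · have h0 : 0 ≤ M - ‖x + g x‖ ^ 2 := sub_nonneg.mpr (hMC x hx)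
      have h1 : M - ‖x + g x‖ ^ 2 ≤ M - δ ^ 2 :=
        sub_le_sub_left (pow_le_pow_left₀ hδ0.le (hδ x hx) 2) M
      exact (mul_le_mul_of_nonneg_left (le_abs_self _) (pow_nonneg h0 N)).trans
        (mul_le_mul_of_nonneg_right (pow_le_pow_left₀ h0 h1 N) (abs_nonneg _))
  set v := volume.real (closedBall (0 : V) (δ / 2))
  have hv : 0 < v := ENNReal.toReal_pos (measure_closedBall_pos _ _ (by positivity)).ne'
    measure_closedBall_lt_top.ne
  have hlower : ∀ N : ℕ, (M - (δ / 2) ^ 2) ^ N * v ≤ ∫ x in B, (M - ‖x‖ ^ 2) ^ N := by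
    intro N
    have hsub : closedBall (0 : V) (δ / 2) ⊆ B := closedBall_subset_closedBall (by linarith)
    have hc : Continuous fun x : V => (M - ‖x‖ ^ 2) ^ N := by fun_prop
    calc (M - (δ / 2) ^ 2) ^ N * v
        = ∫ x in closedBall (0 : V) (δ / 2), (M - (δ / 2) ^ 2) ^ N := by
          rw [setIntegral_const, smul_eq_mul, mul_comm]
      _ ≤ ∫ x in closedBall (0 : V) (δ / 2), (M - ‖x‖ ^ 2) ^ N := by
          refine setIntegral_mono_on (integrableOn_const measure_closedBall_lt_top.ne)
            (hc.continuousOn.integrableOn_compact (isCompact_closedBall _ _))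
            measurableSet_closedBall fun x hx => ?_
          rw [mem_closedBall_zero_iff] at hx
          refine pow_le_pow_left₀ (by nlinarith) ?_ N
          have := pow_le_pow_left₀ (norm_nonneg x) hx 2
          linarith
      _ ≤ ∫ x in B, (M - ‖x‖ ^ 2) ^ N := by
          refine setIntegral_mono_set (hc.continuousOn.integrableOn_compact hBc) ?_
            hsub.eventuallyLE
          filter_upwards [ae_restrict_mem hBc.measurableSet] with x hx
          have := pow_le_pow_left₀ (norm_nonneg x) (mem_closedBall_zero_iff.mp hx) 2
          exact pow_nonneg (by linarith) N
  have ha : 0 < M - (δ / 2) ^ 2 := by nlinarith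
  set r := (M - δ ^ 2) / (M - (δ / 2) ^ 2)
  have hr0 : 0 ≤ r := div_nonneg (by linarith) ha.le
  have hr1 : r < 1 := (div_lt_one ha).mpr (by nlinarith)
  have hvr : ∀ N : ℕ, v ≤ r ^ N * D := by
    intro N
    have h := (hlower N).trans (hupper N)
    rw [div_pow, div_mul_eq_mul_div, le_div_iff₀ (pow_pos ha N)]
    linarith
  have hlim : Tendsto (fun N : ℕ => r ^ N * D) atTop (𝓝 0) := by
    simpa using (tendsto_pow_atTop_nhds_zero_of_lt_one hr0 hr1).mul_const D
  exact hv.not_ge (ge_of_tendsto' hlim hvr)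

/-- A continuous vector field with `a ‖x‖² - b ‖x‖ ≤ ⟪f x, x⟫` for some `a > 0` has a zero. -/
theorem exists_eq_zero_of_coercive [FiniteDimensional ℝ V] {f : V → V}
    (hf : Continuous f) {a b : ℝ} (ha : 0 < a)
    (hcoer : ∀ x, a * ‖x‖ ^ 2 - b * ‖x‖ ≤ inner ℝ (f x) x) : ∃ x, f x = 0 := by
  set R := max ((b + 1) / a) 0 + 1
  have hR0 : 0 < R := by positivity
  have hRa : b + 1 < a * R := by
    have : (b + 1) / a < R := (le_max_left _ _).trans_lt (lt_add_one _)
    rwa [div_lt_iff₀' ha] at this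
  by_contra! hne
  obtain ⟨x₀, -, hmin⟩ := (isCompact_closedBall (0 : V) R).exists_isMinOn
    ⟨0, mem_closedBall_self hR0.le⟩ hf.norm.continuousOn
  obtain ⟨η, hη0, hη1, hη⟩ : ∃ η > 0, η ≤ 1 ∧ ∀ x ∈ closedBall (0 : V) R, η ≤ ‖f x‖ :=
    ⟨min 1 ‖f x₀‖, lt_min one_pos (norm_pos_iff.mpr (hne x₀)), min_le_left _ _,
      fun x hx => (min_le_right _ _).trans (hmin hx)⟩
  obtain ⟨p, hp, hpf, -⟩ := hf.exists_contDiff_approx 1 (continuous_const (y := η)) fun _ => hη0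
  have hpos : ∀ x, R < ‖x‖ → 0 < inner ℝ (p x) x := by
    intro x hx
    have h1 : |inner ℝ (p x - f x) x| ≤ ‖p x - f x‖ * ‖x‖ := abs_real_inner_le_norm _ _
    have h2 : ‖p x - f x‖ < η := by simpa [dist_eq_norm] using hpf x
    have h3 := hcoer x
    rw [inner_sub_left] at h1
    have h4 := (abs_le.mp h1).1
    have h5 : ‖p x - f x‖ * ‖x‖ ≤ 1 * ‖x‖ :=
      mul_le_mul_of_nonneg_right (h2.le.trans hη1) (norm_nonneg _)
    have h6 : 0 < ‖x‖ := hR0.trans hx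
    have h7 : a * R < a * ‖x‖ := mul_lt_mul_of_pos_left hx ha
    have h8 : 0 < (a * ‖x‖ - b - 1) * ‖x‖ := mul_pos (by linarith) h6
    nlinarith
  let χ : ContDiffBump (0 : V) := ⟨R, R + 1, hR0, lt_add_one R⟩
  obtain ⟨x, hx⟩ := ContDiff.exists_add_eq_zero_of_hasCompactSupport
    (g := fun x => χ x • (p x - x)) (χ.contDiff.smul (hp.sub contDiff_id))
    χ.hasCompactSupport.smul_right
  by_cases hxR : ‖x‖ ≤ R
  · have hxB : x ∈ closedBall (0 : V) R := mem_closedBall_zero_iff.mpr hxR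
    have hpx : p x = 0 := by
      have h1 : χ x = 1 := χ.one_of_mem_closedBall hxB
      simpa [h1] using hx
    have h2 := hpf x
    rw [hpx, dist_zero_left] at h2
    exact (hη x hxB).not_gt h2
  · push Not at hxR
    have h1 : inner ℝ (x + χ x • (p x - x)) x = (0 : ℝ) := by rw [hx, inner_zero_left]
    rw [inner_add_left, inner_smul_left, inner_sub_left, real_inner_self_eq_norm_sq] at h1
    simp only [conj_trivial] at h1
    have h2 := hpos x hxR
    have h3 : 0 ≤ χ x := χ.nonneg
    have h4 : χ x ≤ 1 := χ.le_one
    have h5 : 0 < ‖x‖ ^ 2 := pow_pos (hR0.trans hxR) 2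
    rcases h4.lt_or_eq with h | h
    · nlinarith [mul_nonneg h3 h2.le, mul_pos (sub_pos.mpr h) h5]
    · rw [h] at h1
      linarith

end

theorem abstract_existence_fixed_point
    {V : Type*} [NormedAddCommGroup V] [InnerProductSpace ℝ V]
    [FiniteDimensional ℝ V]
    (A : V → V → V → ℝ) (ν : ℝ) (hν : 0 < ν)
    (hadd₁ : ∀ κ u₁ u₂ v, A κ (u₁ + u₂) v = A κ u₁ v + A κ u₂ v)
    (hsmul₁ : ∀ κ (c : ℝ) u v, A κ (c • u) v = c * A κ u v)
    (hadd₂ : ∀ κ u v₁ v₂, A κ u (v₁ + v₂) = A κ u v₁ + A κ u v₂)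
    (hsmul₂ : ∀ κ (c : ℝ) u v, A κ u (c • v) = c * A κ u v)
    (hcoer : ∀ v, ν * ‖v‖ ^ 2 ≤ A v v v)
    (hcont : ∀ (κl : ℕ → V) (κ : V),
      Filter.Tendsto κl Filter.atTop (nhds κ) →
        ∀ v, Filter.Tendsto (fun l => A (κl l) (κl l) v) Filter.atTop
          (nhds (A κ κ v))) :
    ∀ F : V →L[ℝ] ℝ, ∃ u : V, ∀ v, A u u v = F v := by
  intro F
  let e := stdOrthonormalBasis ℝ V
  let T : V → V →ₗ[ℝ] ℝ := fun u =>
    { toFun := fun v => A u u v - F v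
      map_add' := fun x y => by rw [hadd₂, map_add]; ring
      map_smul' := fun c x => by
        rw [hsmul₂, map_smul, smul_eq_mul, RingHom.id_apply, smul_eq_mul]; ring }
  let f : V → V := fun u => ∑ i, T u (e i) • e i
  have hfT : ∀ u v, inner ℝ (f u) v = T u v := by
    intro u v
    conv_rhs => rw [← e.sum_repr v, map_sum]
    simp only [f, sum_inner, inner_smul_left, map_smul, smul_eq_mul, e.repr_apply_apply,
      conj_trivial]
    exact Finset.sum_congr rfl fun i _ => mul_comm _ _
  have hf : Continuous f := by
    refine continuous_finsetSum _ fun i _ => Continuous.smul ?_ continuous_const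
    refine Continuous.sub (f := fun u => A u u (e i)) ?_ continuous_const
    exact continuous_iff_seqContinuous.mpr fun κl κ h => hcont κl κ h (e i)
  obtain ⟨u, hu⟩ := exists_eq_zero_of_coercive hf (a := ν) (b := ‖F‖) hν fun x => by
    rw [hfT]
    have h1 := hcoer x
    have h2 := (le_abs_self (F x)).trans (F.le_opNorm x)
    change _ ≤ A x x x - F x
    linarith
  refine ⟨u, fun v => ?_⟩
  have h := hfT u v
  rw [hu, inner_zero_left] at h
  exact (sub_eq_zero.mp (h.symm : A u u v - F v = 0))
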